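/- Let e ≥ 2 and r ≥ 2 be integers. Suppose c ≤ d are integers and v_1,…,v_m ∈ {c, c+1, …, d} ∖ 𝟙_r. Then in the m-wedge space Λ^m_{e,r}, the wedge |v_1⟩∧…∧|v_m⟩ lies in the ℚ(q)-span of the set of ordered wedges |w_1⟩∧…∧|w_m⟩ (with w_1 > … > w_m) satisfying w_1,…,w_m ∈ {c, c+1, …, d} ∖ 𝟙_r, Σ_{i=1}^m X_c(w_i) = Σ_{i=1}^m X_c(v_i) and Σ_{i=1}^m Y_c(w_i) = Σ_{i=1}^m Y_c(v_i). -/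

import Mathlib

noncomputable section

/-- The field `ℚ(q)` of rational functions. -/
abbrev K : Type := RatFunc ℚ

/-- The element `q` of `ℚ(q)`. -/
def qK : K := RatFunc.X

/-- `a_{r'}(t)`: the unique element of `{1,…,e}` congruent to `t` modulo `e`
(this does not depend on `r'`). -/
def aFun (e t : ℤ) : ℤ := (t - 1) % e + 1

/-- `b_{r'}(t)`: the unique element of `{1,…,r'}` such that
`t = a_{r'}(t) + e (b_{r'}(t) − 1) − e r' m` for some integer `m`. -/
def bFun (e r t : ℤ) : ℤ := (t - 1) % (e * r) / e + 1

/-- `m_{r'}(t)`: the unique integer with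
`t = a_{r'}(t) + e (b_{r'}(t) − 1) − e r' m_{r'}(t)`. -/
def mFun (e r t : ℤ) : ℤ := (aFun e t + e * (bFun e r t - 1) - t) / (e * r)

/-- The free `ℚ(q)`-module on the set of `l`-tuples of integers
(the basis element at `(t₁,…,t_l)` is the formal wedge `|t₁⟩∧…∧|t_l⟩`). -/
abbrev FW (l : ℕ) := (Fin l → ℤ) →₀ K

/-- The formal two-entry wedge `|x⟩∧|y⟩` in the free module on pairs. -/
def pairTerm (x y : ℤ) : (ℤ × ℤ) →₀ K := Finsupp.single (x, y) 1

/-- The sum `Σ_{m ≥ m0} coeff m · |u−γ−Nm⟩∧|t+γ+Nm⟩`, where `m` ranges only over those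
values for which the displayed wedge is ordered (first entry strictly bigger).  Since
`N ≥ 2` and `γ ≥ 0` in all uses, all such `m` satisfy `m ≤ (u−t).toNat`, so the
following finite sum captures all of them. -/
def pairSum (N t u γ : ℤ) (m0 : ℕ) (coeff : ℕ → K) : (ℤ × ℤ) →₀ K :=
  ∑ m ∈ Finset.Ico m0 ((u - t).toNat + 1),
    if t + γ + N * m < u - γ - N * m then coeff m • pairTerm (u - γ - N * m) (t + γ + N * m)
    else 0

/-- For `t ≤ u`, the right-hand side of the straightening relation for `|t⟩∧|u⟩`
in the wedge space with parameters `e, r`. -/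
def pairRHS (e r t u : ℤ) : (ℤ × ℤ) →₀ K :=
  let N := e * r
  let α := (aFun e u - aFun e t) % N
  let β := (e * (bFun e r u - bFun e r t)) % N
  if α = 0 ∧ β = 0 then -pairTerm u t
  else if β = 0 then
    -(qK⁻¹ • pairTerm u t) +
      (qK ^ (-2 : ℤ) - 1) •
        (pairSum N t u α 0 (fun m => qK ^ (-2 * (m : ℤ))) -
          pairSum N t u 0 1 (fun m => qK ^ (1 - 2 * (m : ℤ))))
  else if α = 0 then
    -(qK • pairTerm u t) +
      (qK ^ (2 : ℤ) - 1) •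
        (pairSum N t u β 0 (fun m => qK ^ (2 * (m : ℤ))) -
          pairSum N t u 0 1 (fun m => qK ^ (2 * (m : ℤ) - 1)))
  else
    -pairTerm u t +
      (qK - qK⁻¹) • pairSum N t u β 0
        (fun m => (qK ^ (2 * (m : ℤ) + 1) + qK ^ (-2 * (m : ℤ) - 1)) / (qK + qK⁻¹)) +
      (qK⁻¹ - qK) • pairSum N t u α 0
        (fun m => (qK ^ (2 * (m : ℤ) + 1) + qK ^ (-2 * (m : ℤ) - 1)) / (qK + qK⁻¹)) +
      (qK - qK⁻¹) • pairSum N t u (α + β) 0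
        (fun m => (qK ^ (2 * (m : ℤ) + 2) - qK ^ (-2 * (m : ℤ) - 2)) / (qK + qK⁻¹)) +
      (qK⁻¹ - qK) • pairSum N t u 0 1
        (fun m => (qK ^ (2 * (m : ℤ)) - qK ^ (-2 * (m : ℤ))) / (qK + qK⁻¹))

/-- Replace the entries of an `l`-tuple at positions `j` and `j+1` by `p.1` and `p.2`. -/
def updPair (l : ℕ) (ts : Fin l → ℤ) (j : ℕ) (p : ℤ × ℤ) : Fin l → ℤ :=
  fun i => if (i : ℕ) = j then p.1 else if (i : ℕ) = j + 1 then p.2 else ts i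

/-- The set of straightening relators: for every `l`-tuple `ts` and every pair of
adjacent positions `j, j+1` with `ts j ≤ ts (j+1)`, the element
`|ts⟩ − (RHS of the straightening relation applied at positions j, j+1)`. -/
def relSet (e r : ℤ) (l : ℕ) : Set (FW l) :=
  {x | ∃ (ts : Fin l → ℤ) (j j' : Fin l), (j' : ℕ) = (j : ℕ) + 1 ∧ ts j ≤ ts j' ∧
      x = Finsupp.single ts 1 -
        (pairRHS e r (ts j) (ts j')).sum fun p c => Finsupp.single (updPair l ts (j : ℕ) p) c}

/-- The `l`-wedge space `Λ^l_{e,r}`: the quotient of the free module on `l`-tuples by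
the straightening relations. -/
abbrev WedgeSpace (e r : ℤ) (l : ℕ) := FW l ⧸ Submodule.span K (relSet e r l)

/-- The image of the wedge `|ts 0⟩∧…∧|ts (l−1)⟩` in the `l`-wedge space. -/
def wedge (e r : ℤ) (l : ℕ) (ts : Fin l → ℤ) : WedgeSpace e r l :=
  Submodule.Quotient.mk (Finsupp.single ts 1)

/-- `X_c(v) = |{c, …, v} ∩ 𝟙_r|`. -/
def Xc (e r c v : ℤ) : ℕ := ((Finset.Icc c v).filter fun t => bFun e r t = 1).card

/-- `Y_c(v) = |{c, …, v} ∩ 𝟙_r ∩ (v + eℤ)}|`. -/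
def Yc (e r c v : ℤ) : ℕ :=
  ((Finset.Icc c v).filter fun t => bFun e r t = 1 ∧ t % e = v % e).card

section Residues

variable {e r : ℤ}

theorem one_le_aFun (he : 0 < e) (t : ℤ) : 1 ≤ aFun e t := by
  have := Int.emod_nonneg (t - 1) he.ne'
  unfold aFun; omega

theorem aFun_le (he : 0 < e) (t : ℤ) : aFun e t ≤ e := by
  have := Int.emod_lt_of_pos (t - 1) he
  unfold aFun; omega

theorem one_le_bFun (he : 0 < e) (hr : 0 < r) (t : ℤ) : 1 ≤ bFun e r t := by
  have := Int.ediv_nonneg (Int.emod_nonneg (t - 1) (mul_pos he hr).ne') he.le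
  unfold bFun; omega

theorem bFun_le (he : 0 < e) (hr : 0 < r) (t : ℤ) : bFun e r t ≤ r := by
  have : (t - 1) % (e * r) / e < r :=
    Int.ediv_lt_of_lt_mul he (by
      rw [mul_comm r e]; exact Int.emod_lt_of_pos _ (mul_pos he hr))
  unfold bFun; omega

theorem eq_aFun_add_bFun_add (e r t : ℤ) :
    t = aFun e t + e * (bFun e r t - 1) + e * r * ((t - 1) / (e * r)) := by
  have h1 := Int.emod_add_mul_ediv (t - 1) (e * r)
  have h2 := Int.emod_add_mul_ediv ((t - 1) % (e * r)) e
  rw [Int.emod_emod_of_dvd _ (dvd_mul_right e r)] at h2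
  unfold aFun bFun
  linear_combination -h1 - h2

theorem emod_eq_of_decomp {a b k x : ℤ} (ha : 1 ≤ a) (ha' : a ≤ e) (hb : 1 ≤ b)
    (hb' : b ≤ r) (hx : x = a + e * (b - 1) + e * r * k) :
    (x - 1) % (e * r) = a - 1 + e * (b - 1) := by
  have : x - 1 = a - 1 + e * (b - 1) + e * r * k := by linarith
  rw [this, Int.add_mul_emod_self_left]
  apply Int.emod_eq_of_lt <;> nlinarith

theorem aFun_eq_of_decomp {a b k x : ℤ} (ha : 1 ≤ a) (ha' : a ≤ e)
    (hx : x = a + e * (b - 1) + e * r * k) : aFun e x = a := by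
  have : x - 1 = a - 1 + e * (b - 1 + r * k) := by linarith
  rw [aFun, this, Int.add_mul_emod_self_left, Int.emod_eq_of_lt (by omega) (by omega)]
  omega

theorem bFun_eq_of_decomp {a b k x : ℤ} (ha : 1 ≤ a) (ha' : a ≤ e) (hb : 1 ≤ b)
    (hb' : b ≤ r) (hx : x = a + e * (b - 1) + e * r * k) : bFun e r x = b := by
  rw [bFun, emod_eq_of_decomp ha ha' hb hb' hx, Int.add_mul_ediv_left _ _ (by omega),
    Int.ediv_eq_zero_of_lt (by omega) (by omega)]
  omega

theorem bFun_eq_one_iff (he : 0 < e) (hr : 0 < r) (t : ℤ) :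
    bFun e r t = 1 ↔ (t - 1) % (e * r) < e := by
  have h0 := Int.emod_nonneg (t - 1) (mul_pos he hr).ne'
  unfold bFun
  constructor
  · intro h
    have : (t - 1) % (e * r) / e < 1 := by omega
    simpa using (Int.ediv_lt_iff_lt_mul he).1 this
  · intro h
    rw [Int.ediv_eq_zero_of_lt h0 h]; rfl

/-- An integer lies in the first block with residue `a` modulo `e` iff it is congruent to `a`
modulo `e * r`. -/
theorem bFun_eq_one_and_emod_eq_iff (he : 0 < e) (hr : 0 < r) (t v : ℤ) :
    (bFun e r t = 1 ∧ t % e = v % e) ↔ (t - aFun e v) % (e * r) = 0 := by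
  have ha := one_le_aFun he v
  have ha' := aFun_le he v
  constructor
  · rintro ⟨hb, hv⟩
    have h1 := eq_aFun_add_bFun_add e r t
    have h2 : aFun e t = aFun e v := by
      unfold aFun
      rw [(Int.ModEq.sub_right 1 hv : (t - 1) % e = (v - 1) % e)]
    rw [hb, h2] at h1
    exact Int.emod_eq_zero_of_dvd ⟨(t - 1) / (e * r), by linarith⟩
  · intro h
    obtain ⟨k, hk⟩ := Int.dvd_of_emod_eq_zero h
    refine ⟨bFun_eq_of_decomp (k := k) ha ha' le_rfl (by omega) (by linarith), ?_⟩
    have h3 := Int.emod_add_mul_ediv (v - 1) e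
    have : t = v + e * (r * k - (v - 1) / e) := by
      unfold aFun at hk
      linear_combination hk + h3
    rw [this, Int.add_mul_emod_self_left]

end Residues

section Counting

variable {e r : ℤ}

/-- A telescoping count of the integers in `{c, …, v}` satisfying `P`. -/
theorem card_filter_Icc_eq_sub (P : ℤ → Prop) [DecidablePred P] (f : ℤ → ℤ)
    (hf : ∀ n, f n = f (n - 1) + if P n then 1 else 0) {c v : ℤ} (hcv : c - 1 ≤ v) :
    (((Finset.Icc c v).filter P).card : ℤ) = f v - f (c - 1) := by
  induction v, hcv using Int.leInduction with
  | base => simp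
  | succ n hn ih =>
    have : Finset.Icc c (n + 1) = insert (n + 1) (Finset.Icc c n) := by
      ext x; simp only [Finset.mem_Icc, Finset.mem_insert]; omega
    have hn' : n + 1 ∉ (Finset.Icc c n).filter P := by simp
    rw [this, Finset.filter_insert, hf (n + 1), add_sub_cancel_right]
    split_ifs
    · rw [Finset.card_insert_of_notMem hn']; push_cast; linarith
    · linarith

/-- Increment of `n ↦ n / N` and of `n ↦ n % N`. -/
theorem ediv_emod_pred {N : ℤ} (hN : 0 < N) (n : ℤ) :
    (n % N = 0 ∧ (n - 1) / N = n / N - 1 ∧ (n - 1) % N = N - 1) ∨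
      (0 < n % N ∧ (n - 1) / N = n / N ∧ (n - 1) % N = n % N - 1) := by
  have h0 := Int.emod_nonneg n hN.ne'
  have h1 := Int.emod_lt_of_pos n hN
  have h2 := Int.emod_add_mul_ediv n N
  rcases h0.eq_or_lt with h | h
  · left
    obtain ⟨h3, h4⟩ := (Int.ediv_emod_unique (a := n - 1) (r := N - 1) (q := n / N - 1) hN).2
      ⟨by linarith, by omega, by omega⟩
    exact ⟨h.symm, h3, h4⟩
  · right
    obtain ⟨h3, h4⟩ := (Int.ediv_emod_unique (a := n - 1) (r := n % N - 1) (q := n / N) hN).2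
      ⟨by linarith, by omega, by omega⟩
    exact ⟨h, h3, h4⟩

/-- Outside the first block, `X_c(v)` is affine in the period number of `v`. -/
theorem exists_Xc_eq (he : 0 < e) (hr : 0 < r) (c : ℤ) : ∃ C : ℤ, ∀ v, c ≤ v →
    bFun e r v ≠ 1 → (Xc e r c v : ℤ) = e * ((v - 1) / (e * r)) + C := by
  have hN := mul_pos he hr
  have heN : e ≤ e * r := le_mul_of_one_le_right he.le hr
  let f : ℤ → ℤ := fun n => e * ((n - 1) / (e * r)) + min e ((n - 1) % (e * r) + 1)
  have hf : ∀ n, f n = f (n - 1) + if bFun e r n = 1 then 1 else 0 := by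
    intro n
    simp only [f, bFun_eq_one_iff he hr]
    rcases ediv_emod_pred hN (n - 1) with ⟨h1, h2, h3⟩ | ⟨h1, h2, h3⟩
    · rw [h1, h2, h3, mul_sub, if_pos he]; omega
    · rw [h2, h3]; split_ifs <;> omega
  refine ⟨e - f (c - 1), fun v hv hb => ?_⟩
  rw [Xc, card_filter_Icc_eq_sub _ f hf (by omega)]
  rw [Ne, bFun_eq_one_iff he hr] at hb
  simp only [f]
  rw [min_eq_left (by omega)]; ring

theorem exists_Yc_eq (he : 0 < e) (hr : 0 < r) (c : ℤ) : ∃ C : ℤ → ℤ, ∀ v, c ≤ v →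
    (Yc e r c v : ℤ) = (v - 1) / (e * r) + C (aFun e v) := by
  have hN := mul_pos he hr
  refine ⟨fun a => - ((c - 1 - a) / (e * r)), fun v hv => ?_⟩
  have hf : ∀ n, (n - aFun e v) / (e * r) = (n - 1 - aFun e v) / (e * r) +
      if bFun e r n = 1 ∧ n % e = v % e then 1 else 0 := by
    intro n
    simp only [bFun_eq_one_and_emod_eq_iff he hr]
    rw [show n - 1 - aFun e v = n - aFun e v - 1 by ring]
    rcases ediv_emod_pred hN (n - aFun e v) with ⟨h1, h2, h3⟩ | ⟨h1, h2, h3⟩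
    · rw [if_pos h1]; omega
    · rw [if_neg h1.ne']; omega
  rw [Yc, card_filter_Icc_eq_sub _ (fun n => (n - aFun e v) / (e * r)) hf (by omega)]
  have h1 := eq_aFun_add_bFun_add e r v
  have hb := one_le_bFun he hr v
  have hb' := bFun_le he hr v
  have : (v - aFun e v) / (e * r) = (v - 1) / (e * r) := by
    have h2 : v - aFun e v = e * (bFun e r v - 1) + e * r * ((v - 1) / (e * r)) := by
      linarith
    rw [h2, Int.add_mul_ediv_left _ _ hN.ne', Int.ediv_eq_zero_of_lt (by nlinarith)
      (by nlinarith), zero_add]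
  rw [this]; ring

end Counting

section Straightening

variable {e r : ℤ}

/-- The unordered pairs of values of `f` on `p` and on `(t, u)` agree. -/
def SameValues (f : ℤ → ℤ) (t u : ℤ) (p : ℤ × ℤ) : Prop :=
  (f p.1 = f u ∧ f p.2 = f t) ∨ (f p.1 = f t ∧ f p.2 = f u)

/-- The ordered pairs lying between `t` and `u`, with the same sum and the same residues. -/
def exchangePairs (e r t u : ℤ) : Set (ℤ × ℤ) :=
  {p | p.2 < p.1 ∧ t ≤ p.2 ∧ p.1 + p.2 = t + u ∧
    SameValues (aFun e) t u p ∧ SameValues (bFun e r) t u p}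

theorem mem_exchangePairs (he : 0 < e) (hr : 0 < r) {t u δ i j q : ℤ} (hδ : 0 ≤ δ)
    (hlt : t + δ < u - δ) (hi : i = 0 ∨ i = 1) (hj : j = 0 ∨ j = 1)
    (h : δ = i * (aFun e u - aFun e t) + j * (e * (bFun e r u - bFun e r t)) + e * r * q) :
    (u - δ, t + δ) ∈ exchangePairs e r t u := by
  have hu := eq_aFun_add_bFun_add e r u
  have ht := eq_aFun_add_bFun_add e r t
  have au := one_le_aFun he u
  have au' := aFun_le he u
  have at1 := one_le_aFun he t
  have at' := aFun_le he t
  have bu := one_le_bFun he hr u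
  have bu' := bFun_le he hr u
  have bt := one_le_bFun he hr t
  have bt' := bFun_le he hr t
  set ku := (u - 1) / (e * r)
  set kt := (t - 1) / (e * r)
  refine ⟨hlt, by simpa using hδ, by ring, ?_, ?_⟩
  · rcases hi with rfl | rfl
    · left
      constructor
      · exact aFun_eq_of_decomp (r := r) (b := bFun e r u - j * (bFun e r u - bFun e r t))
          (k := ku - q) au au' (by rw [h]; linear_combination hu)
      · exact aFun_eq_of_decomp (r := r) (b := bFun e r t + j * (bFun e r u - bFun e r t))
          (k := kt + q) at1 at' (by rw [h]; linear_combination ht)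
    · right
      constructor
      · exact aFun_eq_of_decomp (r := r) (b := bFun e r u - j * (bFun e r u - bFun e r t))
          (k := ku - q) at1 at' (by rw [h]; linear_combination hu)
      · exact aFun_eq_of_decomp (r := r) (b := bFun e r t + j * (bFun e r u - bFun e r t))
          (k := kt + q) au au' (by rw [h]; linear_combination ht)
  · have hb1 : 1 ≤ aFun e u - i * (aFun e u - aFun e t) := by
      rcases hi with rfl | rfl <;> omega
    have hb2 : aFun e u - i * (aFun e u - aFun e t) ≤ e := by
      rcases hi with rfl | rfl <;> omega
    have hb3 : 1 ≤ aFun e t + i * (aFun e u - aFun e t) := by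
      rcases hi with rfl | rfl <;> omega
    have hb4 : aFun e t + i * (aFun e u - aFun e t) ≤ e := by
      rcases hi with rfl | rfl <;> omega
    rcases hj with rfl | rfl
    · left
      constructor
      · exact bFun_eq_of_decomp (k := ku - q) hb1 hb2 bu bu' (by rw [h]; linear_combination hu)
      · exact bFun_eq_of_decomp (k := kt + q) hb3 hb4 bt bt' (by rw [h]; linear_combination ht)
    · right
      constructor
      · exact bFun_eq_of_decomp (k := ku - q) hb1 hb2 bt bt' (by rw [h]; linear_combination hu)
      · exact bFun_eq_of_decomp (k := kt + q) hb3 hb4 bu bu' (by rw [h]; linear_combination ht)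

theorem pairSum_mem_supported (he : 0 < e) (hr : 0 < r) {t u γ i j q : ℤ} (hγ : 0 ≤ γ)
    (hi : i = 0 ∨ i = 1) (hj : j = 0 ∨ j = 1)
    (h : γ = i * (aFun e u - aFun e t) + j * (e * (bFun e r u - bFun e r t)) + e * r * q)
    (m0 : ℕ) (coeff : ℕ → K) :
    pairSum (e * r) t u γ m0 coeff ∈ Finsupp.supported K K (exchangePairs e r t u) := by
  refine Submodule.sum_mem _ fun m _ => ?_
  split_ifs with hlt
  · refine Submodule.smul_mem _ _ (Finsupp.single_mem_supported K _ ?_)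
    have hm : 0 ≤ e * r * (m : ℤ) := mul_nonneg (mul_pos he hr).le (Int.natCast_nonneg m)
    have := mem_exchangePairs he hr (t := t) (u := u) (δ := γ + e * r * m) (q := q + m) (i := i) (j := j)
      (by omega) (by linarith) hi hj (by rw [h]; ring)
    rwa [← sub_sub, ← add_assoc] at this
  · exact Submodule.zero_mem _

/-- The straightening of `|t⟩∧|u⟩` for `t < u` only involves exchanged pairs. -/
theorem pairRHS_mem_supported (he : 0 < e) (hr : 0 < r) {t u : ℤ} (htu : t < u) :
    pairRHS e r t u ∈ Finsupp.supported K K (exchangePairs e r t u) := by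
  have hN := mul_pos he hr
  have hα := Int.emod_nonneg (aFun e u - aFun e t) hN.ne'
  have hβ := Int.emod_nonneg (e * (bFun e r u - bFun e r t)) hN.ne'
  have hα' := Int.emod_def (aFun e u - aFun e t) (e * r)
  have hβ' := Int.emod_def (e * (bFun e r u - bFun e r t)) (e * r)
  have h0 : pairTerm u t ∈ Finsupp.supported K K (exchangePairs e r t u) := by
    refine Finsupp.single_mem_supported K _ ?_
    simpa using mem_exchangePairs he hr (δ := 0) (q := 0) (i := 0) (j := 0) (t := t) (u := u)
      le_rfl (by simpa using htu) (.inl rfl) (.inl rfl) (by ring)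
  have hz := pairSum_mem_supported he hr (t := t) (u := u) (γ := 0) (q := 0) (i := 0) (j := 0)
    le_rfl (.inl rfl) (.inl rfl) (by ring)
  have ha := pairSum_mem_supported he hr (t := t) (u := u) (i := 1) (j := 0)
    (q := -((aFun e u - aFun e t) / (e * r))) hα (.inr rfl) (.inl rfl)
    (by rw [hα']; ring)
  have hb := pairSum_mem_supported he hr (t := t) (u := u) (i := 0) (j := 1)
    (q := -(e * (bFun e r u - bFun e r t) / (e * r))) hβ (.inl rfl) (.inr rfl)
    (by rw [hβ']; ring)
  have hab := pairSum_mem_supported he hr (t := t) (u := u) (i := 1) (j := 1)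
    (q := -((aFun e u - aFun e t) / (e * r)) - e * (bFun e r u - bFun e r t) / (e * r))
    (add_nonneg hα hβ) (.inr rfl) (.inr rfl) (by rw [hα', hβ']; ring)
  unfold pairRHS
  dsimp only
  split_ifs
  · exact neg_mem h0
  · exact add_mem (neg_mem (Submodule.smul_mem _ _ h0))
      (Submodule.smul_mem _ _ (sub_mem (ha _ _) (hz _ _)))
  · exact add_mem (neg_mem (Submodule.smul_mem _ _ h0))
      (Submodule.smul_mem _ _ (sub_mem (hb _ _) (hz _ _)))
  · exact add_mem (add_mem (add_mem (add_mem (neg_mem h0) (Submodule.smul_mem _ _ (hb _ _)))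
      (Submodule.smul_mem _ _ (ha _ _))) (Submodule.smul_mem _ _ (hab _ _)))
      (Submodule.smul_mem _ _ (hz _ _))

theorem SameValues.add_eq {f : ℤ → ℤ} {t u : ℤ} {p : ℤ × ℤ} (h : SameValues f t u p)
    (g : ℤ → ℤ) : g (f p.1) + g (f p.2) = g (f t) + g (f u) := by
  rcases h with ⟨h1, h2⟩ | ⟨h1, h2⟩ <;> rw [h1, h2]
  exact add_comm _ _

/-- Exchanged pairs have the same total period number. -/
theorem period_add_eq (he : 0 < e) (hr : 0 < r) {t u : ℤ} {p : ℤ × ℤ}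
    (hp : p ∈ exchangePairs e r t u) :
    (p.1 - 1) / (e * r) + (p.2 - 1) / (e * r) = (t - 1) / (e * r) + (u - 1) / (e * r) := by
  obtain ⟨-, -, hs, ha, hb⟩ := hp
  have ha := ha.add_eq id
  have hb := hb.add_eq id
  simp only [id] at ha hb
  have h1 := eq_aFun_add_bFun_add e r p.1
  have h2 := eq_aFun_add_bFun_add e r p.2
  have h3 := eq_aFun_add_bFun_add e r t
  have h4 := eq_aFun_add_bFun_add e r u
  apply mul_left_cancel₀ (mul_pos he hr).ne'
  linear_combination hs - ha - e * hb - h1 - h2 + h3 + h4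

theorem wedge_eq_sum (e r : ℤ) {l : ℕ} (ts : Fin l → ℤ) {j j' : Fin l}
    (hj : (j' : ℕ) = (j : ℕ) + 1) (h : ts j ≤ ts j') :
    wedge e r l ts = (pairRHS e r (ts j) (ts j')).sum
      fun p c => c • wedge e r l (updPair l ts j p) := by
  have hmem : (Submodule.Quotient.mk (Finsupp.single ts 1) : WedgeSpace e r l) =
      Submodule.Quotient.mk ((pairRHS e r (ts j) (ts j')).sum
        fun p c => Finsupp.single (updPair l ts (j : ℕ) p) c) :=
    (Submodule.Quotient.eq _).2 (Submodule.subset_span ⟨ts, j, j', hj, h, rfl⟩)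
  rw [wedge, hmem, ← Submodule.mkQ_apply, Finsupp.sum, map_sum, Finsupp.sum]
  refine Finset.sum_congr rfl fun p _ => ?_
  rw [wedge, ← Submodule.mkQ_apply, ← map_smul, Finsupp.smul_single, smul_eq_mul, mul_one]

theorem updPair_self {l : ℕ} (ts : Fin l → ℤ) {j j' : Fin l}
    (hj : (j' : ℕ) = (j : ℕ) + 1) : updPair l ts j (ts j, ts j') = ts := by
  funext i
  unfold updPair
  split_ifs with h1 h2
  · rw [Fin.ext h1]
  · rw [show i = j' from Fin.ext (h2.trans hj.symm)]
  · rfl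

theorem wedge_eq_zero_of_eq (e r : ℤ) {l : ℕ} (ts : Fin l → ℤ) {j j' : Fin l}
    (hj : (j' : ℕ) = (j : ℕ) + 1) (h : ts j = ts j') : wedge e r l ts = 0 := by
  have h1 := wedge_eq_sum e r ts hj h.le
  have h2 : pairRHS e r (ts j) (ts j') = Finsupp.single (ts j, ts j') (-1) := by
    simp [pairRHS, pairTerm, h]
  rw [h2, Finsupp.sum_single_index (by rw [zero_smul]), updPair_self ts hj, neg_one_smul] at h1
  have h3 : (2 : K) • wedge e r l ts = 0 := by
    rw [two_smul]; exact eq_neg_iff_add_eq_zero.1 h1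
  exact (smul_eq_zero.1 h3).resolve_left two_ne_zero

end Straightening

theorem Fin.sum_add_eq_sum_add {l : ℕ} {M : Type*} [AddCommMonoid M] (f g : Fin l → M)
    {j j' : Fin l} (hj : j ≠ j') (h : ∀ i, i ≠ j → i ≠ j' → f i = g i) :
    ∑ i, f i + (g j + g j') = ∑ i, g i + (f j + f j') := by
  have key : ∀ k : Fin l → M,
      ∑ i, k i = k j + (k j' + ∑ i ∈ (Finset.univ.erase j).erase j', k i) := fun k => by
    rw [Finset.add_sum_erase _ _ (by simp [hj.symm]), Finset.add_sum_erase _ _ (by simp)]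
  have : ∑ i ∈ (Finset.univ.erase j).erase j', f i =
      ∑ i ∈ (Finset.univ.erase j).erase j', g i :=
    Finset.sum_congr rfl fun i hi => by
      simp only [Finset.mem_erase] at hi
      exact h i hi.2.1 hi.1
  rw [key f, key g, this]
  abel

theorem exists_adjacent_le_of_not_strictAnti {l : ℕ} {v : Fin l → ℤ} (h : ¬ StrictAnti v) :
    ∃ j j' : Fin l, (j' : ℕ) = (j : ℕ) + 1 ∧ v j ≤ v j' := by
  cases l with
  | zero => exact absurd (fun i => i.elim0) h
  | succ n =>
    rw [Fin.strictAnti_iff_succ_lt] at h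
    push Not at h
    obtain ⟨i, hi⟩ := h
    exact ⟨i.castSucc, i.succ, by simp, hi⟩

/-- For `e ≥ 2`, `r ≥ 2`, `c ≤ d` and `v₁,…,v_m ∈ {c,…,d} ∖ 𝟙_r`, the
wedge `|v₁⟩∧…∧|v_m⟩` lies in the span of the ordered wedges `|w₁⟩∧…∧|w_m⟩` with entries
in `{c,…,d} ∖ 𝟙_r`, the same total `Σ X_c` and the same total `Σ Y_c`. -/
theorem wedge_mem_span_sameXY (e r : ℤ) (he : 2 ≤ e) (hr : 2 ≤ r)
    (c d : ℤ) (hcd : c ≤ d) (m : ℕ) (v : Fin m → ℤ)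
    (hv : ∀ i, v i ∈ Set.Icc c d ∧ bFun e r (v i) ≠ 1) :
    wedge e r m v ∈ Submodule.span K
      {w : WedgeSpace e r m | ∃ ws : Fin m → ℤ, StrictAnti ws ∧
        (∀ i, ws i ∈ Set.Icc c d ∧ bFun e r (ws i) ≠ 1) ∧
        (∑ i, Xc e r c (ws i)) = (∑ i, Xc e r c (v i)) ∧
        (∑ i, Yc e r c (ws i)) = (∑ i, Yc e r c (v i)) ∧
        w = wedge e r m ws} := by
  have he' : 0 < e := by omega
  have hr' : 0 < r := by omega
  obtain ⟨CX, hX⟩ := exists_Xc_eq he' hr' c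
  obtain ⟨CY, hY⟩ := exists_Yc_eq he' hr' c
  induction hn : (∑ i : Fin m, (i : ℤ) * (v i - c)).toNat using Nat.strong_induction_on
    generalizing v with
  | _ n ih =>
  by_cases hanti : StrictAnti v
  · exact Submodule.subset_span ⟨v, hanti, hv, rfl, rfl, rfl⟩
  obtain ⟨j, j', hj, hle⟩ := exists_adjacent_le_of_not_strictAnti hanti
  rcases hle.eq_or_lt with heq | hlt
  · rw [wedge_eq_zero_of_eq e r v hj heq]
    exact Submodule.zero_mem _
  have hne : j ≠ j' := fun h => by rw [h] at hj; omega
  rw [wedge_eq_sum e r v hj hle]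
  refine Submodule.sum_mem _ fun p hp => Submodule.smul_mem _ _ ?_
  have hp : p ∈ exchangePairs e r (v j) (v j') :=
    (Finsupp.mem_supported K _).1 (pairRHS_mem_supported he' hr' hlt) hp
  have hk := period_add_eq he' hr' hp
  obtain ⟨hlt', hjle, hsum, ha, hb⟩ := hp
  set w := updPair m v j p with hw
  have hwj : w j = p.1 := by simp [hw, updPair]
  have hwj' : w j' = p.2 := by simp [hw, updPair, hj]
  have hwi : ∀ i, i ≠ j → i ≠ j' → w i = v i := fun i h1 h2 => by
    have h1 : (i : ℕ) ≠ j := fun h => h1 (Fin.ext h)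
    have h2 : (i : ℕ) ≠ j + 1 := fun h => h2 (Fin.ext (h.trans hj.symm))
    simp [hw, updPair, h1, h2]
  have hvj := hv j
  have hvj' := hv j'
  simp only [Set.mem_Icc] at hvj hvj'
  have hp1 : p.1 ∈ Set.Icc c d ∧ bFun e r p.1 ≠ 1 := by
    refine ⟨⟨by omega, by omega⟩, ?_⟩
    rcases hb with ⟨h, -⟩ | ⟨h, -⟩ <;> rw [h]
    exacts [hvj'.2, hvj.2]
  have hp2 : p.2 ∈ Set.Icc c d ∧ bFun e r p.2 ≠ 1 := by
    refine ⟨⟨by omega, by omega⟩, ?_⟩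
    rcases hb with ⟨-, h⟩ | ⟨-, h⟩ <;> rw [h]
    exacts [hvj.2, hvj'.2]
  have hwv : ∀ i, w i ∈ Set.Icc c d ∧ bFun e r (w i) ≠ 1 := by
    intro i
    by_cases h1 : i = j
    · rw [h1, hwj]; exact hp1
    by_cases h2 : i = j'
    · rw [h2, hwj']; exact hp2
    rw [hwi i h1 h2]; exact hv i
  have hXsum : ∑ i, Xc e r c (w i) = ∑ i, Xc e r c (v i) := by
    have h := Fin.sum_add_eq_sum_add (fun i => Xc e r c (w i)) (fun i => Xc e r c (v i)) hne
      fun i h1 h2 => by rw [hwi i h1 h2]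
    have h2 : Xc e r c (w j) + Xc e r c (w j') = Xc e r c (v j) + Xc e r c (v j') := by
      zify
      rw [hwj, hwj', hX _ hp1.1.1 hp1.2, hX _ hp2.1.1 hp2.2, hX _ hvj.1.1 hvj.2,
        hX _ hvj'.1.1 hvj'.2]
      linear_combination e * hk
    omega
  have hYsum : ∑ i, Yc e r c (w i) = ∑ i, Yc e r c (v i) := by
    have h := Fin.sum_add_eq_sum_add (fun i => Yc e r c (w i)) (fun i => Yc e r c (v i)) hne
      fun i h1 h2 => by rw [hwi i h1 h2]
    have h2 : Yc e r c (w j) + Yc e r c (w j') = Yc e r c (v j) + Yc e r c (v j') := by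
      zify
      rw [hwj, hwj', hY _ hp1.1.1, hY _ hp2.1.1, hY _ hvj.1.1, hY _ hvj'.1.1]
      linear_combination hk + ha.add_eq CY
    omega
  have hdec : (∑ i : Fin m, (i : ℤ) * (w i - c)).toNat < n := by
    have h := Fin.sum_add_eq_sum_add (fun i : Fin m => (i : ℤ) * (w i - c))
      (fun i : Fin m => (i : ℤ) * (v i - c)) hne fun i h1 h2 => by rw [hwi i h1 h2]
    have hjc : (j' : ℤ) = j + 1 := by exact_mod_cast hj
    have hnn : 0 ≤ ∑ i : Fin m, (i : ℤ) * (w i - c) := Finset.sum_nonneg fun i _ =>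
      mul_nonneg (Int.natCast_nonneg _) (sub_nonneg.2 (hwv i).1.1)
    have h2 : ((j : ℤ) * (v j - c) + j' * (v j' - c)) -
        ((j : ℤ) * (w j - c) + j' * (w j' - c)) = v j' - p.2 := by
      rw [hwj, hwj', hjc]
      linear_combination -(j : ℤ) * hsum
    omega
  simpa only [hXsum, hYsum] using ih _ hdec w hwv rfl

end
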